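/- Let X be a complete CAT(0) space and let F : X → ℝ be λ-convex and locally Lipschitz. Let μ : [0,a) → X be a locally Lipschitz gradient curve of F and let ν : [0,b) → X be a locally Lipschitz gradient curve of F with ν(0) = μ(ℓ₁) for some ℓ₁ ∈ [0,a). Then the gradient flow has the semigroup property: for all ℓ₂ ≥ 0 with ℓ₂ < b and ℓ₁ + ℓ₂ < a, one has ν(ℓ₂) = μ(ℓ₁ + ℓ₂). -/

import Mathlib

open Metric Filter

/-- A geodesic (parametrized on `[0,1]`) in a metric space. -/
def IsGeodesic {X : Type*} [MetricSpace X] (γ : ℝ → X) : Prop :=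
  ∀ s ∈ Set.Icc (0:ℝ) 1, ∀ t ∈ Set.Icc (0:ℝ) 1,
    dist (γ s) (γ t) = |s - t| * dist (γ 0) (γ 1)

/-- A geodesic metric space: any two points are joined by a geodesic. -/
def GeodesicMetricSpace (X : Type*) [MetricSpace X] : Prop :=
  ∀ x y : X, ∃ γ : ℝ → X, IsGeodesic γ ∧ γ 0 = x ∧ γ 1 = y

/-- CAT(0): geodesic space in which squared distance functions are 2-convex. -/
def Cat0 (X : Type*) [MetricSpace X] : Prop :=
  GeodesicMetricSpace X ∧
  ∀ (y : X) (γ : ℝ → X), IsGeodesic γ → ∀ t ∈ Set.Icc (0:ℝ) 1,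
    dist y (γ t) ^ 2 ≤ (1 - t) * dist y (γ 0) ^ 2 + t * dist y (γ 1) ^ 2
      - t * (1 - t) * dist (γ 0) (γ 1) ^ 2

/-- A geodesically convex subset. -/
def GeoConvex {X : Type*} [MetricSpace X] (Y : Set X) : Prop :=
  ∀ γ : ℝ → X, IsGeodesic γ → γ 0 ∈ Y → γ 1 ∈ Y → ∀ t ∈ Set.Icc (0:ℝ) 1, γ t ∈ Y

/-- A `λ`-convex function on a metric space. -/
def LambdaConvex {X : Type*} [MetricSpace X] (lam : ℝ) (F : X → ℝ) : Prop :=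
  ∀ γ : ℝ → X, IsGeodesic γ → ∀ t ∈ Set.Icc (0:ℝ) 1,
    F (γ t) ≤ (1 - t) * F (γ 0) + t * F (γ 1)
      - t * (1 - t) * (lam / 2) * dist (γ 0) (γ 1) ^ 2

/-- Locally Lipschitz on a subset. -/
def LocLipschitzOn {X Y : Type*} [MetricSpace X] [MetricSpace Y] (f : X → Y) (D : Set X) : Prop :=
  ∀ t ∈ D, ∃ K : NNReal, ∃ ε > 0, LipschitzOnWith K f (D ∩ Metric.ball t ε)

/-- The (downward) absolute gradient `|∇₋F|(x)`. -/
noncomputable def absGradient {X : Type*} [MetricSpace X] (F : X → ℝ) (x : X) : ℝ :=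
  max (Filter.limsup (fun y => (F x - F y) / dist x y) (nhdsWithin x {x}ᶜ)) 0

/-- `m` is a gradient curve of `F` at time `t`. -/
def IsGradientCurveAt {X : Type*} [MetricSpace X] (F : X → ℝ) (m : ℝ → X) (t : ℝ) : Prop :=
  Filter.Tendsto (fun ε : ℝ => dist (m (t + ε)) (m t) / ε) (nhdsWithin 0 (Set.Ioi 0))
    (nhds (absGradient F (m t))) ∧
  Filter.Tendsto (fun ε : ℝ => (F (m (t + ε)) - F (m t)) / ε) (nhdsWithin 0 (Set.Ioi 0))
    (nhds (-(absGradient F (m t)) ^ 2))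

open Set Topology

section

variable {X : Type*} [MetricSpace X]

lemma LocLipschitzOn.continuousOn {Y : Type*} [MetricSpace Y] {f : X → Y} {D : Set X}
    (hf : LocLipschitzOn f D) : ContinuousOn f D := by
  intro t ht
  obtain ⟨K, ε, hε, hK⟩ := hf t ht
  exact (continuousWithinAt_inter (ball_mem_nhds t hε)).1
    (hK.continuousOn t ⟨ht, mem_ball_self hε⟩)

lemma absGradient_nonneg (F : X → ℝ) (x : X) : 0 ≤ absGradient F x := le_max_right _ _

lemma LocallyLipschitz.eventually_sub_le_absGradient {F : X → ℝ} (hF : LocallyLipschitz F) (x : X)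
    {δ : ℝ} (hδ : 0 < δ) :
    ∀ᶠ y in 𝓝 x, F x - F y ≤ (absGradient F x + δ) * dist x y := by
  obtain ⟨K, t, ht, hK⟩ := hF x
  have hbdd : IsBoundedUnder (· ≤ ·) (𝓝[≠] x) (fun y => (F x - F y) / dist x y) := by
    refine ⟨K, eventually_map.2 ?_⟩
    filter_upwards [mem_nhdsWithin_of_mem_nhds ht] with y hy
    refine div_le_of_le_mul₀ dist_nonneg K.2 ?_
    exact (le_abs_self _).trans (hK.dist_le_mul x (mem_of_mem_nhds ht) y hy)
  have hlt : limsup (fun y => (F x - F y) / dist x y) (𝓝[≠] x) < absGradient F x + δ :=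
    (le_max_left _ _).trans_lt (lt_add_of_pos_right _ hδ)
  have hev := eventually_nhdsWithin_iff.1 (eventually_lt_of_limsup_lt hlt hbdd)
  filter_upwards [hev] with y hy
  rcases eq_or_ne y x with rfl | hne
  · simp
  · exact ((div_lt_iff₀ (dist_pos.2 hne.symm)).1 (hy hne)).le

/-- The evolution variational inequality for gradient curves. -/
lemma IsGradientCurveAt.eventually_dist_sq_le (hX : Cat0 X) {lam : ℝ} {F : X → ℝ}
    (hconv : LambdaConvex lam F) (hlip : LocallyLipschitz F) {m : ℝ → X} {t : ℝ}
    (hm : IsGradientCurveAt F m t) (y : X) {η : ℝ} (hη : 0 < η) :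
    ∀ᶠ ε in 𝓝[>] (0 : ℝ), dist (m (t + ε)) y ^ 2 ≤ dist (m t) y ^ 2
      + 2 * ε * (F y - F (m t) - lam / 2 * dist (m t) y ^ 2 + η) := by
  obtain ⟨hp, hq⟩ := hm
  set x := m t
  set G := absGradient F x
  have hG : 0 ≤ G := absGradient_nonneg F x
  set d := dist x y
  obtain ⟨c, hc, hcd⟩ : ∃ c : ℝ, 0 < c ∧ c * d ^ 2 < η := by
    refine ⟨η / (d ^ 2 + 1), by positivity, ?_⟩
    rw [div_mul_eq_mul_div, div_lt_iff₀ (by positivity)]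
    nlinarith
  obtain ⟨δ, hδ, hδc⟩ : ∃ δ : ℝ, 0 < δ ∧ G * δ + δ ^ 2 / 2 < c * η / 2 := by
    have hpos : 0 < c * η / (2 * (G + 1)) := by positivity
    refine ⟨min 1 (c * η / (2 * (G + 1))), lt_min one_pos hpos, ?_⟩
    have h₀ : 0 < min 1 (c * η / (2 * (G + 1))) := lt_min one_pos hpos
    have h₁ := min_le_left 1 (c * η / (2 * (G + 1)))
    have h₂ := min_le_right 1 (c * η / (2 * (G + 1)))
    rw [le_div_iff₀ (by positivity)] at h₂
    nlinarith
  have hε : Tendsto (fun ε : ℝ => ε) (𝓝[>] 0) (𝓝 0) := tendsto_nhdsWithin_of_tendsto_nhds tendsto_id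
  have hdist : Tendsto (fun ε => dist (m (t + ε)) x) (𝓝[>] 0) (𝓝 0) := by
    have h := hp.mul hε
    rw [mul_zero] at h
    refine h.congr' ?_
    filter_upwards [self_mem_nhdsWithin] with ε hpos
    exact div_mul_cancel₀ _ (ne_of_gt hpos)
  have hR : Tendsto (fun ε => dist (m (t + ε)) y) (𝓝[>] 0) (𝓝 d) :=
    (tendsto_iff_dist_tendsto_zero.2 hdist).dist tendsto_const_nhds
  choose γ hγ hγ₀ hγ₁ using fun ε => hX.1 (m (t + ε)) y
  have hcε : Tendsto (fun ε : ℝ => c * ε) (𝓝[>] 0) (𝓝 0) := by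
    simpa using hε.const_mul c
  have hs : ∀ᶠ ε in 𝓝[>] (0 : ℝ), c * ε ∈ Icc (0 : ℝ) 1 := by
    filter_upwards [self_mem_nhdsWithin, hcε.eventually_le_const one_pos] with ε hpos h1
    exact ⟨(mul_pos hc hpos).le, h1⟩
  have hz : Tendsto (fun ε => γ ε (c * ε)) (𝓝[>] 0) (𝓝 x) := by
    rw [tendsto_iff_dist_tendsto_zero]
    have h := (hcε.mul hR).add hdist
    rw [zero_mul, zero_add] at h
    refine squeeze_zero' (Eventually.of_forall fun _ => dist_nonneg) ?_ h
    filter_upwards [hs] with ε hsε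
    refine (dist_triangle _ (m (t + ε)) _).trans ?_
    have h := hγ ε (c * ε) hsε 0 (left_mem_Icc.2 zero_le_one)
    rw [hγ₀, hγ₁, sub_zero, abs_of_nonneg hsε.1] at h
    rw [h]
  have hlim : Tendsto (fun ε => (G + δ) ^ 2 / 2 + (1 - c * ε) * (dist (m (t + ε)) x / ε) ^ 2 / 2
        + c ^ 2 * dist (m (t + ε)) y ^ 2 / 2 + (1 - c * ε) * ((F (m (t + ε)) - F x) / ε)
        + c * (F y - F x) - c * (1 - c * ε) * (lam / 2) * dist (m (t + ε)) y ^ 2) (𝓝[>] 0)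
      (𝓝 ((G + δ) ^ 2 / 2 + (1 - 0) * G ^ 2 / 2 + c ^ 2 * d ^ 2 / 2 + (1 - 0) * (-G ^ 2)
        + c * (F y - F x) - c * (1 - 0) * (lam / 2) * d ^ 2)) := by
    have h1 : Tendsto (fun ε : ℝ => 1 - c * ε) (𝓝[>] 0) (𝓝 (1 - 0)) := hcε.const_sub 1
    exact ((((((h1.mul (hp.pow 2)).div_const 2).const_add _).add
      (((hR.pow 2).const_mul _).div_const 2)).add (h1.mul hq)).add_const _).sub
      (((h1.const_mul c).mul_const _).mul (hR.pow 2))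
  have hlt := hlim.eventually_lt_const (u := c * (F y - F x - lam / 2 * d ^ 2 + η))
    (by nlinarith [mul_lt_mul_of_pos_left hcd hc])
  filter_upwards [hlt, hs, self_mem_nhdsWithin,
    hz.eventually (hlip.eventually_sub_le_absGradient x hδ)] with ε hlt hsε hpos hgrad
  have hpos : 0 < ε := hpos
  have hcat := hX.2 x (γ ε) (hγ ε) (c * ε) hsε
  have hcon := hconv (γ ε) (hγ ε) (c * ε) hsε
  rw [hγ₀, hγ₁] at hcat hcon
  rw [dist_comm x (m (t + ε))] at hcat
  set P := dist (m (t + ε)) x / ε with hP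
  set Q := (F (m (t + ε)) - F x) / ε with hQ
  set u := dist x (γ ε (c * ε)) / ε with hu
  set R := dist (m (t + ε)) y
  have hP' : dist (m (t + ε)) x = P * ε := (div_mul_cancel₀ _ hpos.ne').symm
  have hQ' : F (m (t + ε)) = F x + Q * ε := by
    rw [hQ, div_mul_cancel₀ _ hpos.ne']; ring
  have hu' : dist x (γ ε (c * ε)) = u * ε := (div_mul_cancel₀ _ hpos.ne').symm
  rw [hP', hu'] at hcat
  rw [hQ'] at hcon
  rw [hu'] at hgrad
  change F x - F (γ ε (c * ε)) ≤ (G + δ) * (u * ε) at hgrad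
  change (u * ε) ^ 2 ≤ (1 - c * ε) * (P * ε) ^ 2 + c * ε * d ^ 2
    - c * ε * (1 - c * ε) * R ^ 2 at hcat
  have hslope : -((G + δ) * u) ≤ (1 - c * ε) * Q + c * (F y - F x)
      - c * (1 - c * ε) * (lam / 2) * R ^ 2 := by
    refine le_of_mul_le_mul_right ?_ hpos
    linarith
  have hyoung : (G + δ) * u ≤ (G + δ) ^ 2 / 2 + u ^ 2 / 2 := by
    linarith [sq_nonneg (G + δ - u)]
  have hcat' : ε * u ^ 2 ≤ ε * ((1 - c * ε) * P ^ 2) + c * (d ^ 2 - R ^ 2) + ε * (c ^ 2 * R ^ 2) := by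
    refine le_of_mul_le_mul_right ?_ hpos
    linarith
  have hlow : (1 - c * ε) * P ^ 2 / 2 + c ^ 2 * R ^ 2 / 2 - u ^ 2 / 2
      < c * (F y - F x - lam / 2 * d ^ 2 + η) := by linarith
  have hfin := mul_lt_mul_of_pos_left hlow hpos
  refine le_of_mul_le_mul_left ?_ hc
  linarith

lemma Cat0.exists_midpoint (hX : Cat0 X) {lam : ℝ} {F : X → ℝ} (hconv : LambdaConvex lam F)
    (x y : X) : ∃ w, dist x w = dist x y / 2 ∧ dist y w = dist x y / 2 ∧
      2 * F w ≤ F x + F y - lam / 4 * dist x y ^ 2 := by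
  obtain ⟨γ, hγ, rfl, rfl⟩ := hX.1 x y
  have hmem : (1 / 2 : ℝ) ∈ Icc (0 : ℝ) 1 := by norm_num
  refine ⟨γ (1 / 2), ?_, ?_, ?_⟩
  · rw [hγ 0 (by simp) _ hmem, zero_sub, abs_neg, abs_of_pos (by norm_num)]; ring
  · rw [hγ 1 (by simp) _ hmem, abs_of_pos (by norm_num)]; ring
  · linarith [hconv γ hγ _ hmem]

lemma IsGradientCurveAt.eventually_dist_sq_le_of_pair (hX : Cat0 X) {lam : ℝ} {F : X → ℝ}
    (hconv : LambdaConvex lam F) (hlip : LocallyLipschitz F) {m n : ℝ → X} {s t : ℝ}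
    (hm : IsGradientCurveAt F m s) (hn : IsGradientCurveAt F n t) {η : ℝ} (hη : 0 < η) :
    ∀ᶠ ε in 𝓝[>] (0 : ℝ), dist (m (s + ε)) (n (t + ε)) ^ 2 ≤ dist (m s) (n t) ^ 2
      + ε * (-2 * lam * dist (m s) (n t) ^ 2 + η) := by
  obtain ⟨w, hmw, hnw, hFw⟩ := hX.exists_midpoint hconv (m s) (n t)
  have hη8 : 0 < η / 8 := by positivity
  filter_upwards [hm.eventually_dist_sq_le hX hconv hlip w hη8,
    hn.eventually_dist_sq_le hX hconv hlip w hη8, self_mem_nhdsWithin] with ε hmε hnε hpos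
  rw [hmw] at hmε
  rw [hnw] at hnε
  have htri : dist (m (s + ε)) (n (t + ε)) ≤ dist (m (s + ε)) w + dist (n (t + ε)) w :=
    dist_triangle_right _ _ _
  have hsq := pow_le_pow_left₀ dist_nonneg htri 2
  have hFε := mul_le_mul_of_nonneg_left hFw (le_of_lt hpos)
  linarith [sq_nonneg (dist (m (s + ε)) w - dist (n (t + ε)) w)]

end

theorem stmt8 {X : Type*} [MetricSpace X] [CompleteSpace X] (hX : Cat0 X)
    (lam : ℝ) (F : X → ℝ) (hconv : LambdaConvex lam F) (hlip : LocallyLipschitz F)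
    (a b : ℝ) (μ ν : ℝ → X)
    (hμlip : LocLipschitzOn μ (Set.Ico 0 a)) (hνlip : LocLipschitzOn ν (Set.Ico 0 b))
    (hμgrad : ∀ t ∈ Set.Ico (0:ℝ) a, IsGradientCurveAt F μ t)
    (hνgrad : ∀ t ∈ Set.Ico (0:ℝ) b, IsGradientCurveAt F ν t)
    (ℓ₁ : ℝ) (hℓ₁ : ℓ₁ ∈ Set.Ico (0:ℝ) a) (hν0 : ν 0 = μ ℓ₁) :
    ∀ ℓ₂ : ℝ, 0 ≤ ℓ₂ → ℓ₂ < b → ℓ₁ + ℓ₂ < a → ν ℓ₂ = μ (ℓ₁ + ℓ₂) := by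
  intro ℓ₂ h0 hb ha
  have hμmem : ∀ t ∈ Icc 0 ℓ₂, ℓ₁ + t ∈ Ico 0 a := fun t ht =>
    ⟨add_nonneg hℓ₁.1 ht.1, by linarith [ht.2]⟩
  have hνmem : ∀ t ∈ Icc 0 ℓ₂, t ∈ Ico 0 b := fun t ht => ⟨ht.1, ht.2.trans_lt hb⟩
  have hcont : ContinuousOn (fun t => dist (μ (ℓ₁ + t)) (ν t) ^ 2) (Icc 0 ℓ₂) :=
    (continuous_dist.comp_continuousOn ((hμlip.continuousOn.comp (by fun_prop) hμmem).prodMk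
      (hνlip.continuousOn.mono hνmem))).pow 2
  have hbound := le_gronwallBound_of_liminf_deriv_right_le (δ := 0) (K := -2 * lam) (ε := 0)
    (f' := fun t => -2 * lam * dist (μ (ℓ₁ + t)) (ν t) ^ 2) hcont
    (fun t ht r hr => by
      have htmem := Ico_subset_Icc_self ht
      have hη : 0 < (r - -2 * lam * dist (μ (ℓ₁ + t)) (ν t) ^ 2) / 2 := half_pos (sub_pos.2 hr)
      have hev := (hμgrad _ (hμmem t htmem)).eventually_dist_sq_le_of_pair hX hconv hlip
        (hνgrad _ (hνmem t htmem)) hη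
      have hshift : Tendsto (fun z => z - t) (𝓝[>] t) (𝓝[>] 0) := by
        refine tendsto_nhdsWithin_iff.2 ⟨?_, ?_⟩
        · refine tendsto_nhdsWithin_of_tendsto_nhds ?_
          simpa using (continuous_id.sub continuous_const).tendsto (x := t) (f := fun z => z - t)
        · filter_upwards [self_mem_nhdsWithin] with z hz
          exact sub_pos.2 (mem_Ioi.1 hz)
      refine Eventually.frequently ?_
      filter_upwards [hshift.eventually hev, self_mem_nhdsWithin] with z hz htz
      have hzt : 0 < z - t := sub_pos.2 htz
      rw [show ℓ₁ + t + (z - t) = ℓ₁ + z by ring, add_sub_cancel] at hz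
      rw [inv_mul_lt_iff₀ hzt]
      linarith [mul_pos hzt hη])
    (by simp [hν0]) (fun t _ => by simp) ℓ₂ (right_mem_Icc.2 h0)
  rw [gronwallBound_ε0, zero_mul] at hbound
  have hzero : dist (μ (ℓ₁ + ℓ₂)) (ν ℓ₂) = 0 :=
    pow_eq_zero_iff two_ne_zero |>.1 (le_antisymm hbound (sq_nonneg _))
  exact (dist_eq_zero.1 hzero).symm
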